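/- arXiv:2402.08615 — 2 statements merged into one kernel-verified Lean document; each statement's English description precedes it below -/
import Mathlib

section
/- Let 1 ≤ n ≤ d be integers, let μ be a compactly supported Radon measure on ℝ^d, and let D_μ be a David–Mattila lattice for μ with parameters C₀, A₀. Then for every Q ∈ D_μ and every α ∈ (0,1), ∫_{2B_Q ∖ Q} ( ∫_Q |x−y|^{−n} dμ(y) )² dμ(x) + ∫_Q ( ∫_{2B_Q ∖ Q} |x−y|^{−n} dμ(y) )² dμ(x) ≤ C Σ_{P ∈ D̃_μ(Q)} (ℓ(Q)/ℓ(P))^α θ_μ(2B_P)² μ(P), where C depends only on α, A₀, C₀, d, n. -/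
open MeasureTheory Metric Set Filter Topology
open scoped ENNReal NNReal Classical

noncomputable section

/-- `ℝ^d` as a Euclidean space. -/
abbrev Euc (d : ℕ) : Type := EuclideanSpace ℝ (Fin d)

/-- The support of a measure: the set of points all whose balls have positive measure. -/
def measSupport {d : ℕ} (μ : Measure (Euc d)) : Set (Euc d) :=
  {x | ∀ r : ℝ, 0 < r → 0 < μ (ball x r)}

/-- Side length of the generation-`k` cubes: `ℓ = 56 C₀ A₀^{-k}`. -/
def sideLen (C₀ A₀ : ℝ) (k : ℕ) : ℝ := 56 * C₀ * A₀ ^ (-(k : ℤ))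

/-- The density `θ_μ(B(c,r)) = μ(B(c,r))/rⁿ`. -/
def thetaB {d : ℕ} (n : ℕ) (μ : Measure (Euc d)) (c : Euc d) (r : ℝ) : ℝ≥0∞ :=
  μ (ball c r) / ENNReal.ofReal (r ^ n)

/-- A David–Mattila lattice for a compactly supported Radon measure `μ` on `ℝ^d`, with parameters
`C₀ > 1` and `A₀ > 5000 C₀`: a sequence of partitions `cubes k` of `supp μ` into Borel "cubes",
each carrying a ball `B(Q) = B(center Q, radius Q)`, with the nesting, comparability, disjointness,
small-boundary and non-doubling properties of [David–Mattila]. -/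
structure DMLattice (d : ℕ) (μ : Measure (Euc d)) (C₀ A₀ : ℝ) where
  hC₀ : 1 < C₀
  hA₀ : 5000 * C₀ < A₀
  cubes : ℕ → Set (Set (Euc d))
  center : ℕ → Set (Euc d) → Euc d
  radius : ℕ → Set (Euc d) → ℝ
  borel : ∀ k : ℕ, ∀ Q ∈ cubes k, MeasurableSet Q
  cover : ∀ k : ℕ, ⋃₀ cubes k = measSupport μ
  disj : ∀ k : ℕ, (cubes k).PairwiseDisjoint id
  nested : ∀ k l : ℕ, k < l → ∀ Q ∈ cubes l, ∀ R ∈ cubes k, Q ∩ R = ∅ ∨ Q ⊆ R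
  center_mem : ∀ k : ℕ, ∀ Q ∈ cubes k, center k Q ∈ measSupport μ
  radius_lb : ∀ k : ℕ, ∀ Q ∈ cubes k, A₀ ^ (-(k : ℤ)) ≤ radius k Q
  radius_ub : ∀ k : ℕ, ∀ Q ∈ cubes k, radius k Q ≤ C₀ * A₀ ^ (-(k : ℤ))
  ball_subset : ∀ k : ℕ, ∀ Q ∈ cubes k, measSupport μ ∩ ball (center k Q) (radius k Q) ⊆ Q
  subset_ball : ∀ k : ℕ, ∀ Q ∈ cubes k, Q ⊆ measSupport μ ∩ ball (center k Q) (28 * radius k Q)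
  balls_disjoint : ∀ k : ℕ, ∀ Q ∈ cubes k, ∀ R ∈ cubes k, Q ≠ R →
    Disjoint (ball (center k Q) (5 * radius k Q)) (ball (center k R) (5 * radius k R))
  small_boundaries : ∃ C : ℝ, 0 < C ∧ ∀ k : ℕ, ∀ Q ∈ cubes k, ∀ l : ℕ,
    μ ({x ∈ measSupport μ \ Q | Metric.infDist x Q < A₀ ^ (-(k : ℤ) - (l : ℤ))} ∪
        {x ∈ Q | Metric.infDist x (measSupport μ \ Q) < A₀ ^ (-(k : ℤ) - (l : ℤ))}) ≤
      ENNReal.ofReal ((C⁻¹ * C₀ ^ (-(3 * (d : ℤ) + 1)) * A₀) ^ (-(l : ℤ))) *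
        μ (ball (center k Q) (90 * radius k Q))
  non_doubling_radius : ∀ k : ℕ, ∀ Q ∈ cubes k,
    ¬ μ (ball (center k Q) (100 * radius k Q)) ≤
        ENNReal.ofReal C₀ * μ (ball (center k Q) (radius k Q)) →
      radius k Q = A₀ ^ (-(k : ℤ))
  non_doubling_decay : ∀ k : ℕ, ∀ Q ∈ cubes k,
    ¬ μ (ball (center k Q) (100 * radius k Q)) ≤
        ENNReal.ofReal C₀ * μ (ball (center k Q) (radius k Q)) →
      ∀ l : ℕ, 1 ≤ l → (100 : ℝ) ^ l ≤ C₀ →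
        μ (ball (center k Q) (100 * radius k Q)) ≤
          ENNReal.ofReal (C₀ ^ (-(l : ℤ))) *
            μ (ball (center k Q) ((100 : ℝ) ^ (l + 1) * radius k Q))

/-- The dilated cube `λQ`: the union of the same-generation cubes `P` with
`dist(x_Q, P) ≤ λ ℓ(Q)`. -/
def DMLattice.dilate {d : ℕ} {μ : Measure (Euc d)} {C₀ A₀ : ℝ} (L : DMLattice d μ C₀ A₀)
    (lam : ℝ) (k : ℕ) (Q : Set (Euc d)) : Set (Euc d) :=
  ⋃₀ {P ∈ L.cubes k | Metric.infDist (L.center k Q) P ≤ lam * sideLen C₀ A₀ k}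

/-- The quantity
`∫_{B∖Q} (∫_Q |x-y|^{-n} dμ(y))² dμ(x) + ∫_Q (∫_{B∖Q} |x-y|^{-n} dμ(y))² dμ(x)`. -/
def sqIntLHS {d : ℕ} (n : ℕ) (μ : Measure (Euc d)) (B Q : Set (Euc d)) : ℝ≥0∞ :=
  (∫⁻ x in B \ Q, (∫⁻ y in Q, (ENNReal.ofReal (‖x - y‖ ^ n))⁻¹ ∂μ) ^ 2 ∂μ) +
    (∫⁻ x in Q, (∫⁻ y in B \ Q, (ENNReal.ofReal (‖x - y‖ ^ n))⁻¹ ∂μ) ^ 2 ∂μ)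

/-- Membership of a generation-`j` cube `P` in the family `D̃_μ(Q)` associated with a
generation-`k` cube `Q`: either `P ⊆ Q` and `2B_P` meets `supp μ ∖ Q`, or `ℓ(P) ≤ ℓ(Q)`,
`P ⊆ ℝ^d ∖ Q` and `2B_P` meets `Q`. -/
def memTildeD {d : ℕ} {μ : Measure (Euc d)} {C₀ A₀ : ℝ} (L : DMLattice d μ C₀ A₀)
    (k : ℕ) (Q : Set (Euc d)) (j : ℕ) (P : Set (Euc d)) : Prop :=
  (P ⊆ Q ∧ (ball (L.center j P) (56 * L.radius j P) ∩ (measSupport μ \ Q)).Nonempty) ∨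
    (k ≤ j ∧ P ⊆ Qᶜ ∧ (ball (L.center j P) (56 * L.radius j P) ∩ Q).Nonempty)

/-- The sum `Σ_{P ∈ D̃_μ(Q)} (ℓ(Q)/ℓ(P))^α θ_μ(2B_P)² μ(P)` for `Q` a generation-`k` cube. -/
def tildeSum {d : ℕ} {μ : Measure (Euc d)} {C₀ A₀ : ℝ} (L : DMLattice d μ C₀ A₀)
    (n : ℕ) (α : ℝ) (k : ℕ) (Q : Set (Euc d)) : ℝ≥0∞ :=
  ∑' (j : ℕ), ∑' (P : L.cubes j),
    if memTildeD L k Q j (P : Set (Euc d)) then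
      ENNReal.ofReal ((sideLen C₀ A₀ k / sideLen C₀ A₀ j) ^ α) *
        thetaB n μ (L.center j (P : Set (Euc d))) (56 * L.radius j (P : Set (Euc d))) ^ 2 *
        μ (P : Set (Euc d))
    else 0

theorem ENNReal.two_mul_le_sq_add_sq (a b : ℝ≥0∞) : 2 * (a * b) ≤ a ^ 2 + b ^ 2 := by
  rcases eq_or_ne a ∞ with rfl | ha
  · simp
  rcases eq_or_ne b ∞ with rfl | hb
  · simp
  lift a to ℝ≥0 using ha
  lift b to ℝ≥0 using hb
  norm_cast
  rw [← mul_assoc]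
  exact two_mul_le_add_sq a b

theorem ENNReal.add_sq_le_two_mul (a b : ℝ≥0∞) : (a + b) ^ 2 ≤ 2 * a ^ 2 + 2 * b ^ 2 := by
  calc (a + b) ^ 2 = a ^ 2 + b ^ 2 + 2 * (a * b) := by ring
    _ ≤ a ^ 2 + b ^ 2 + (a ^ 2 + b ^ 2) := by gcongr; exact two_mul_le_sq_add_sq a b
    _ = 2 * a ^ 2 + 2 * b ^ 2 := by ring

/-- The Cauchy–Schwarz inequality for series with values in `ℝ≥0∞`. -/
theorem ENNReal.tsum_mul_sq_le {ι : Type*} (f g : ι → ℝ≥0∞) :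
    (∑' i, f i * g i) ^ 2 ≤ (∑' i, f i ^ 2) * ∑' i, g i ^ 2 := by
  have key : 2 * (∑' i, f i * g i) ^ 2 ≤ 2 * ((∑' i, f i ^ 2) * ∑' i, g i ^ 2) := by
    calc 2 * (∑' i, f i * g i) ^ 2
        = ∑' i, ∑' j, 2 * ((f i * g j) * (f j * g i)) := by
          simp_rw [sq, ← ENNReal.tsum_mul_right, ← ENNReal.tsum_mul_left]
          refine tsum_congr fun i => tsum_congr fun j => by ring
      _ ≤ ∑' i, ∑' j, ((f i * g j) ^ 2 + (f j * g i) ^ 2) := by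
          gcongr
          exact two_mul_le_sq_add_sq _ _
      _ = 2 * ((∑' i, f i ^ 2) * ∑' i, g i ^ 2) := by
          simp_rw [ENNReal.tsum_add, mul_pow, ENNReal.tsum_mul_left, ENNReal.tsum_mul_right,
            ENNReal.tsum_mul_left]
          ring
  exact (ENNReal.mul_le_mul_iff_right (by simp) (by simp)).1 key

theorem measSupport_eq_support {d : ℕ} (μ : Measure (Euc d)) : measSupport μ = μ.support := by
  ext x
  rw [(nhds_basis_ball (x := x)).mem_measureSupport]
  rfl

theorem ae_mem_measSupport {d : ℕ} (μ : Measure (Euc d)) : ∀ᵐ x ∂μ, x ∈ measSupport μ := by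
  rw [measSupport_eq_support]
  exact Measure.support_mem_ae

namespace DMLattice

variable {d : ℕ} {μ : Measure (Euc d)} {C₀ A₀ : ℝ}

theorem one_lt_A₀ (L : DMLattice d μ C₀ A₀) : 1 < A₀ := by linarith [L.hC₀, L.hA₀]

theorem radius_pos (L : DMLattice d μ C₀ A₀) {k : ℕ} {Q : Set (Euc d)} (hQ : Q ∈ L.cubes k) :
    0 < L.radius k Q :=
  (zpow_pos (zero_lt_one.trans L.one_lt_A₀) _).trans_le (L.radius_lb k Q hQ)

theorem countable_cubes (L : DMLattice d μ C₀ A₀) (k : ℕ) : (L.cubes k).Countable := by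
  refine Set.PairwiseDisjoint.countable_of_isOpen
    (s := fun Q => ball (L.center k Q) (5 * L.radius k Q)) ?_ (fun _ _ => isOpen_ball) ?_
  · intro Q hQ R hR hne
    exact L.balls_disjoint k Q hQ R hR hne
  · intro Q hQ
    exact ⟨_, mem_ball_self (by linarith [L.radius_pos hQ])⟩

theorem eq_empty_or_subset (L : DMLattice d μ C₀ A₀)
    {k j : ℕ} (hkj : k ≤ j) {P Q : Set (Euc d)} (hP : P ∈ L.cubes j)
    (hQ : Q ∈ L.cubes k) : P ∩ Q = ∅ ∨ P ⊆ Q := by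
  rcases hkj.eq_or_lt with rfl | h
  · by_cases hPQ : P = Q
    · exact Or.inr hPQ.subset
    · exact Or.inl (Set.disjoint_iff_inter_eq_empty.1 (L.disj k hP hQ hPQ))
  · exact L.nested k j h P hP Q hQ

/-- If `s ≥ 28 A₀^{-(j+1)}`, then `μ(2B_P) / sⁿ` is at most a multiple of `θ_μ(2B_P)` for `P` of
generation `j`. -/
theorem measure_mul_inv_le_thetaB (L : DMLattice d μ C₀ A₀)
    (n : ℕ) {j : ℕ} {P : Set (Euc d)} (hP : P ∈ L.cubes j)
    {s : ℝ} (hs : 28 * A₀ ^ (-(j : ℤ)) / A₀ ≤ s) :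
    μ (ball (L.center j P) (56 * L.radius j P)) * (ENNReal.ofReal (s ^ n))⁻¹ ≤
      ENNReal.ofReal ((2 * C₀ * A₀) ^ n) *
        thetaB n μ (L.center j P) (56 * L.radius j P) := by
  have hA := L.one_lt_A₀
  have hz : 0 < A₀ ^ (-(j : ℤ)) := zpow_pos (by linarith) _
  have hs0 : 0 < s := lt_of_lt_of_le (by positivity) hs
  have hr := L.radius_pos hP
  have hC := L.hC₀
  rw [thetaB, ENNReal.div_eq_inv_mul, ← mul_assoc, mul_comm]
  gcongr
  rw [← ENNReal.ofReal_inv_of_pos (by positivity), ← ENNReal.ofReal_inv_of_pos (by positivity),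
    ← ENNReal.ofReal_mul (by positivity)]
  apply ENNReal.ofReal_le_ofReal
  rw [← inv_pow, ← inv_pow, ← mul_pow]
  gcongr
  rw [← div_eq_mul_inv, inv_le_comm₀ hs0 (by positivity), inv_div, div_le_iff₀ (by positivity)]
  rw [div_le_iff₀ (by positivity)] at hs
  nlinarith [L.radius_ub j P hP]

end DMLattice

theorem inv_norm_pow_le_tsum {E : Type*} [NormedAddCommGroup E] (n : ℕ) {A₀ : ℝ} (hA : 1 < A₀)
    (k : ℕ) {x y : E} (hxy : x ≠ y) :
    (ENNReal.ofReal (‖x - y‖ ^ n))⁻¹ ≤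
      (ENNReal.ofReal ((28 * A₀ ^ (-(k : ℤ))) ^ n))⁻¹ +
      ∑' m : ℕ, (closedBall x (28 * A₀ ^ (-((k + m : ℕ) : ℤ)))).indicator
        (fun _ => (ENNReal.ofReal ((28 * A₀ ^ (-((k + m : ℕ) : ℤ)) / A₀) ^ n))⁻¹) y := by
  have hA0 : 0 < A₀ := by linarith
  have hz : 0 < A₀ ^ (-(k : ℤ)) := zpow_pos hA0 _
  have hpos : 0 < ‖x - y‖ := norm_pos_iff.2 (sub_ne_zero.2 hxy)
  rcases le_total (28 * A₀ ^ (-(k : ℤ))) ‖x - y‖ with h | h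
  · refine le_add_right ?_
    gcongr
  · refine le_add_left ?_
    obtain ⟨m, hm1, hm2⟩ := exists_nat_pow_near_of_lt_one
      (x := ‖x - y‖ / (28 * A₀ ^ (-(k : ℤ)))) (y := A₀⁻¹) (by positivity)
      ((div_le_one (by positivity)).2 h) (by positivity) (inv_lt_one_of_one_lt₀ hA)
    rw [lt_div_iff₀ (by positivity)] at hm1
    rw [div_le_iff₀ (by positivity)] at hm2
    have e : A₀ ^ (-((k + m : ℕ) : ℤ)) = A₀ ^ (-(k : ℤ)) * A₀⁻¹ ^ m := by
      rw [Nat.cast_add, neg_add, zpow_add₀ hA0.ne', inv_pow, zpow_neg A₀ (m : ℤ), zpow_natCast]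
    refine le_trans ?_ (ENNReal.le_tsum m)
    rw [indicator_of_mem]
    · gcongr
      rw [e, div_eq_mul_inv]
      refine le_of_eq_of_le ?_ hm1.le
      ring
    · rw [mem_closedBall, dist_comm, dist_eq_norm, e]
      refine hm2.trans_eq ?_
      ring

namespace DMLattice

variable {d : ℕ} {μ : Measure (Euc d)} {C₀ A₀ : ℝ}

/-- If the cubes `P ∋ x` whose ball `2B_P` meets `E` all satisfy `p`, then the potential of `μ|_E`
at `x` is bounded by a far contribution and the densities of these cubes. -/
theorem lintegral_inv_norm_pow_le (L : DMLattice d μ C₀ A₀)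
    (n : ℕ) (k : ℕ) (p : ℕ → Set (Euc d) → Prop)
    {E : Set (Euc d)} (hE : MeasurableSet E) {x : Euc d} (hxE : x ∉ E)
    (P : ℕ → Set (Euc d)) (hP : ∀ m, P m ∈ L.cubes (k + m)) (hxP : ∀ m, x ∈ P m)
    (hp : ∀ m, ∀ y ∈ E, y ∈ measSupport μ →
      y ∈ ball (L.center (k + m) (P m)) (56 * L.radius (k + m) (P m)) → p (k + m) (P m)) :
    ∫⁻ y in E, (ENNReal.ofReal (‖x - y‖ ^ n))⁻¹ ∂μ ≤
      (ENNReal.ofReal ((28 * A₀ ^ (-(k : ℤ))) ^ n))⁻¹ * μ E +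
      ENNReal.ofReal ((2 * C₀ * A₀) ^ n) * ∑' m : ℕ, if p (k + m) (P m) then
        thetaB n μ (L.center (k + m) (P m)) (56 * L.radius (k + m) (P m)) else 0 := by
  have hA := L.one_lt_A₀
  calc ∫⁻ y in E, (ENNReal.ofReal (‖x - y‖ ^ n))⁻¹ ∂μ
      ≤ ∫⁻ y in E, ((ENNReal.ofReal ((28 * A₀ ^ (-(k : ℤ))) ^ n))⁻¹ +
      ∑' m : ℕ, (closedBall x (28 * A₀ ^ (-((k + m : ℕ) : ℤ)))).indicator
        (fun _ => (ENNReal.ofReal ((28 * A₀ ^ (-((k + m : ℕ) : ℤ)) / A₀) ^ n))⁻¹) y) ∂μ := by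
        refine setLIntegral_mono' hE fun y hy => inv_norm_pow_le_tsum n hA k ?_
        rintro rfl
        exact hxE hy
    _ = (ENNReal.ofReal ((28 * A₀ ^ (-(k : ℤ))) ^ n))⁻¹ * μ E +
      ∑' m : ℕ, (ENNReal.ofReal ((28 * A₀ ^ (-((k + m : ℕ) : ℤ)) / A₀) ^ n))⁻¹ *
        μ (closedBall x (28 * A₀ ^ (-((k + m : ℕ) : ℤ))) ∩ E) := by
        rw [lintegral_add_left measurable_const, setLIntegral_const, lintegral_tsum]
        · congr 1
          refine tsum_congr fun m => ?_
          rw [lintegral_indicator measurableSet_closedBall, setLIntegral_const,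
            Measure.restrict_apply measurableSet_closedBall]
        · intro m
          exact (measurable_const.indicator measurableSet_closedBall).aemeasurable
    _ ≤ _ := by
        rw [← ENNReal.tsum_mul_left]
        refine add_le_add le_rfl (ENNReal.tsum_le_tsum fun m => ?_)
        have hsub : closedBall x (28 * A₀ ^ (-((k + m : ℕ) : ℤ))) ⊆
            ball (L.center (k + m) (P m)) (56 * L.radius (k + m) (P m)) := by
          intro y hy
          have h1 := (L.subset_ball _ _ (hP m) (hxP m)).2
          have h2 := L.radius_lb _ _ (hP m)
          rw [mem_ball] at h1 ⊢
          rw [mem_closedBall] at hy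
          linarith [dist_triangle y x (L.center (k + m) (P m))]
        split_ifs with h
        · rw [mul_comm]
          refine le_trans ?_ (L.measure_mul_inv_le_thetaB n (hP m) le_rfl)
          gcongr
          exact inter_subset_left.trans hsub
        · have : μ (closedBall x (28 * A₀ ^ (-((k + m : ℕ) : ℤ))) ∩ E) = 0 := by
            refine measure_mono_null ?_ (ae_iff.1 (ae_mem_measSupport μ))
            exact fun y hy hys => h (hp m y hy.2 hys (hsub hy.1))
          rw [this, mul_zero]
          exact zero_le

theorem sideLen_div (L : DMLattice d μ C₀ A₀) (k m : ℕ) :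
    sideLen C₀ A₀ k / sideLen C₀ A₀ (k + m) = A₀ ^ m := by
  have hA := L.one_lt_A₀
  have hC := L.hC₀
  have hA0 : 0 < A₀ := by linarith
  rw [sideLen, sideLen, mul_div_mul_left _ _ (by positivity), Nat.cast_add, ← zpow_sub₀ hA0.ne']
  simp

/-- The function whose integral is `tildeSum`. -/
def tildeFun (L : DMLattice d μ C₀ A₀)
    (n : ℕ) (α : ℝ) (k : ℕ) (Q : Set (Euc d)) (x : Euc d) : ℝ≥0∞ :=
  ∑' (j : ℕ), ∑' (P : L.cubes j), (P : Set (Euc d)).indicator (fun _ =>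
    if memTildeD L k Q j (P : Set (Euc d)) then
      ENNReal.ofReal ((sideLen C₀ A₀ k / sideLen C₀ A₀ j) ^ α) *
        thetaB n μ (L.center j (P : Set (Euc d))) (56 * L.radius j (P : Set (Euc d))) ^ 2
    else 0) x

theorem lintegral_tildeFun (L : DMLattice d μ C₀ A₀) (n : ℕ) (α : ℝ) (k : ℕ) (Q : Set (Euc d)) :
    ∫⁻ x, L.tildeFun n α k Q x ∂μ = tildeSum L n α k Q := by
  have hc (j : ℕ) : Countable (L.cubes j) := (L.countable_cubes j).to_subtype
  have hm (j : ℕ) (P : L.cubes j) : Measurable ((P : Set (Euc d)).indicator (fun _ =>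
      if memTildeD L k Q j (P : Set (Euc d)) then
        ENNReal.ofReal ((sideLen C₀ A₀ k / sideLen C₀ A₀ j) ^ α) *
          thetaB n μ (L.center j (P : Set (Euc d))) (56 * L.radius j (P : Set (Euc d))) ^ 2
      else 0)) := measurable_const.indicator (L.borel j P P.2)
  unfold tildeFun tildeSum
  rw [lintegral_tsum fun j => (Measurable.tsum (hm j)).aemeasurable]
  refine tsum_congr fun j => ?_
  rw [lintegral_tsum fun P => (hm j P).aemeasurable]
  refine tsum_congr fun P => ?_
  rw [lintegral_indicator (L.borel j P P.2), setLIntegral_const]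
  split_ifs <;> simp

theorem sq_tsum_theta_le (L : DMLattice d μ C₀ A₀)
    (n : ℕ) (α : ℝ) (k : ℕ) (Q : Set (Euc d)) (x : Euc d)
    (P : ℕ → Set (Euc d)) (hP : ∀ m, P m ∈ L.cubes (k + m)) (hxP : ∀ m, x ∈ P m) :
    (∑' m : ℕ, if memTildeD L k Q (k + m) (P m) then
        thetaB n μ (L.center (k + m) (P m)) (56 * L.radius (k + m) (P m)) else 0) ^ 2 ≤
      (1 - ENNReal.ofReal (A₀ ^ (-α)))⁻¹ * L.tildeFun n α k Q x := by
  have hA := L.one_lt_A₀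
  have hA0 : 0 < A₀ := by linarith
  set a : ℕ → ℝ≥0∞ := fun m => if memTildeD L k Q (k + m) (P m) then
        thetaB n μ (L.center (k + m) (P m)) (56 * L.radius (k + m) (P m)) else 0 with ha
  set s : ℝ := A₀ ^ (α / 2) with hs
  have hs0 : 0 < s := by positivity
  have hs2 : s ^ 2 = A₀ ^ α := by
    rw [hs, ← Real.rpow_natCast, ← Real.rpow_mul hA0.le]
    norm_num
  calc (∑' m, a m) ^ 2
      = (∑' m, ENNReal.ofReal (s⁻¹ ^ m) * (ENNReal.ofReal (s ^ m) * a m)) ^ 2 := by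
        congr 1
        refine tsum_congr fun m => ?_
        rw [← mul_assoc, ← ENNReal.ofReal_mul (by positivity), ← mul_pow, inv_mul_cancel₀ hs0.ne']
        simp
    _ ≤ _ := ENNReal.tsum_mul_sq_le _ _
    _ ≤ _ := by
        gcongr ?_ * ?_
        · rw [← ENNReal.tsum_geometric]
          refine (tsum_congr fun m => ?_).le
          rw [← ENNReal.ofReal_pow (by positivity), ← ENNReal.ofReal_pow (by positivity),
            Real.rpow_neg hA0.le, ← hs2]
          congr 1
          rw [← inv_pow, ← pow_mul, ← pow_mul, mul_comm]
        · rw [tildeFun]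
          refine le_trans ?_ (ENNReal.tsum_comp_le_tsum_of_injective (add_right_injective k) _)
          refine ENNReal.tsum_le_tsum fun m => ?_
          refine le_trans ?_ (ENNReal.le_tsum ⟨P m, hP m⟩)
          rw [indicator_of_mem (hxP m), L.sideLen_div, ha]
          dsimp only
          split_ifs
          · rw [mul_pow, ← ENNReal.ofReal_pow (by positivity)]
            refine le_of_eq ?_
            congr 2
            rw [← pow_mul, mul_comm m 2, pow_mul, hs2, ← Real.rpow_natCast,
              ← Real.rpow_natCast, ← Real.rpow_mul hA0.le, ← Real.rpow_mul hA0.le, mul_comm]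
          · simp

/-- Bound for the square integral over `F` of the potential of `μ|_E`. -/
theorem lintegral_sq_le (L : DMLattice d μ C₀ A₀) (n : ℕ) (α : ℝ) (k : ℕ) {Q E F : Set (Euc d)}
    (hE : MeasurableSet E) (hF : MeasurableSet F) (hEF : Disjoint E F)
    (h : ∀ m, ∀ P ∈ L.cubes (k + m), ∀ x ∈ F, x ∈ P → ∀ y ∈ E, y ∈ measSupport μ →
      y ∈ ball (L.center (k + m) P) (56 * L.radius (k + m) P) → memTildeD L k Q (k + m) P) :
    ∫⁻ x in F, (∫⁻ y in E, (ENNReal.ofReal (‖x - y‖ ^ n))⁻¹ ∂μ) ^ 2 ∂μ ≤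
      2 * (((ENNReal.ofReal ((28 * A₀ ^ (-(k : ℤ))) ^ n))⁻¹ * μ E) ^ 2 * μ F) +
      2 * ENNReal.ofReal ((2 * C₀ * A₀) ^ n) ^ 2 * (1 - ENNReal.ofReal (A₀ ^ (-α)))⁻¹ *
        tildeSum L n α k Q := by
  set c := (ENNReal.ofReal ((28 * A₀ ^ (-(k : ℤ))) ^ n))⁻¹ * μ E
  set D := ENNReal.ofReal ((2 * C₀ * A₀) ^ n)
  set S := (1 - ENNReal.ofReal (A₀ ^ (-α)))⁻¹
  have hmeas : Measurable (L.tildeFun n α k Q) := by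
    have hc (j : ℕ) : Countable (L.cubes j) := (L.countable_cubes j).to_subtype
    exact Measurable.tsum fun j => Measurable.tsum fun P =>
      measurable_const.indicator (L.borel j P P.2)
  calc ∫⁻ x in F, (∫⁻ y in E, (ENNReal.ofReal (‖x - y‖ ^ n))⁻¹ ∂μ) ^ 2 ∂μ
      ≤ ∫⁻ x in F, (2 * c ^ 2 + 2 * D ^ 2 * S * L.tildeFun n α k Q x) ∂μ := by
        refine setLIntegral_mono_ae' hF ?_
        filter_upwards [ae_mem_measSupport μ] with x hx hxF
        have hex (m : ℕ) : ∃ P ∈ L.cubes (k + m), x ∈ P := by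
          rw [← L.cover (k + m)] at hx
          exact hx
        choose P hP hxP using hex
        calc (∫⁻ y in E, (ENNReal.ofReal (‖x - y‖ ^ n))⁻¹ ∂μ) ^ 2
            ≤ (c + D * ∑' m : ℕ, if memTildeD L k Q (k + m) (P m) then
              thetaB n μ (L.center (k + m) (P m)) (56 * L.radius (k + m) (P m)) else 0) ^ 2 := by
              gcongr
              exact L.lintegral_inv_norm_pow_le n k (memTildeD L k Q) hE
                (fun hxE => hEF.le_bot ⟨hxE, hxF⟩) P hP hxP
                (fun m => h m (P m) (hP m) x hxF (hxP m))
          _ ≤ _ := ENNReal.add_sq_le_two_mul _ _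
          _ ≤ 2 * c ^ 2 + 2 * (D ^ 2 * (S * L.tildeFun n α k Q x)) := by
              rw [mul_pow D]
              gcongr
              exact L.sq_tsum_theta_le n α k Q x P hP hxP
          _ = _ := by ring
    _ = 2 * c ^ 2 * μ F + 2 * D ^ 2 * S * ∫⁻ x in F, L.tildeFun n α k Q x ∂μ := by
        rw [lintegral_add_left measurable_const, setLIntegral_const, lintegral_const_mul _ hmeas]
    _ ≤ _ := by
        rw [← L.lintegral_tildeFun n α k Q, mul_assoc 2 (c ^ 2)]
        gcongr
        exact Measure.restrict_le_self

theorem theta_sq_mul_measure_le_tildeSum (L : DMLattice d μ C₀ A₀)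
    (n : ℕ) (α : ℝ) {k : ℕ} {Q : Set (Euc d)}
    (hQ : Q ∈ L.cubes k) (h : memTildeD L k Q k Q) :
    thetaB n μ (L.center k Q) (56 * L.radius k Q) ^ 2 * μ Q ≤ tildeSum L n α k Q := by
  rw [tildeSum]
  refine le_trans ?_ (ENNReal.le_tsum k)
  refine le_trans ?_ (ENNReal.le_tsum ⟨Q, hQ⟩)
  have hs : sideLen C₀ A₀ k / sideLen C₀ A₀ k = 1 := by simpa using L.sideLen_div k 0
  simp [h, hs]

theorem sqIntLHS_le (L : DMLattice d μ C₀ A₀)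
    (n : ℕ) (α : ℝ) {k : ℕ} {Q : Set (Euc d)} (hQ : Q ∈ L.cubes k) :
    sqIntLHS n μ (ball (L.center k Q) (56 * L.radius k Q)) Q ≤
      4 * ENNReal.ofReal ((2 * C₀ * A₀) ^ n) ^ 2 * (1 + (1 - ENNReal.ofReal (A₀ ^ (-α)))⁻¹) *
        tildeSum L n α k Q := by
  have hA := L.one_lt_A₀
  have hQm := L.borel k Q hQ
  set B := ball (L.center k Q) (56 * L.radius k Q)
  have hQB : Q ⊆ B := fun x hx =>
    ball_subset_ball (by linarith [L.radius_pos hQ]) (L.subset_ball k Q hQ hx).2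
  have hBQm : MeasurableSet (B \ Q) := measurableSet_ball.diff hQm
  by_cases hne : memTildeD L k Q k Q
  swap
  · have hnull : μ (B \ Q) = 0 := by
      refine measure_mono_null ?_ (ae_iff.1 (ae_mem_measSupport μ))
      exact fun x hx hxs => hne (Or.inl ⟨Subset.rfl, x, hx.1, hxs, hx.2⟩)
    have hr : μ.restrict (B \ Q) = 0 := Measure.restrict_eq_zero.2 hnull
    simp [sqIntLHS, hr]
  set D := ENNReal.ofReal ((2 * C₀ * A₀) ^ n)
  set S := (1 - ENNReal.ofReal (A₀ ^ (-α)))⁻¹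
  set c := (ENNReal.ofReal ((28 * A₀ ^ (-(k : ℤ))) ^ n))⁻¹
  set θ := thetaB n μ (L.center k Q) (56 * L.radius k Q)
  have hcθ : μ B * c ≤ D * θ := by
    refine L.measure_mul_inv_le_thetaB n hQ (div_le_self ?_ hA.le)
    have : 0 < A₀ ^ (-(k : ℤ)) := zpow_pos (by linarith) _
    positivity
  have hfar : (μ B * c) ^ 2 * μ Q ≤ D ^ 2 * tildeSum L n α k Q := by
    calc (μ B * c) ^ 2 * μ Q ≤ (D * θ) ^ 2 * μ Q := by gcongr
      _ = D ^ 2 * (θ ^ 2 * μ Q) := by ring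
      _ ≤ _ := by gcongr; exact L.theta_sq_mul_measure_le_tildeSum n α hQ hne
  have h1 := L.lintegral_sq_le n α k (Q := Q) hQm hBQm disjoint_sdiff_right (by
    intro m P hP x hxF hxP y hy _ hyB
    refine Or.inr ⟨by omega, ?_, y, hyB, hy⟩
    rcases L.eq_empty_or_subset (Nat.le_add_right k m) hP hQ with h | h
    · exact (Set.disjoint_iff_inter_eq_empty.2 h).subset_compl_right
    · exact absurd (h hxP) hxF.2)
  have h2 := L.lintegral_sq_le n α k (Q := Q) hBQm hQm disjoint_sdiff_left (by
    intro m P hP x hxF hxP y hy hys hyB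
    refine Or.inl ⟨?_, y, hyB, hys, hy.2⟩
    rcases L.eq_empty_or_subset (Nat.le_add_right k m) hP hQ with h | h
    · exact absurd (show x ∈ P ∩ Q from ⟨hxP, hxF⟩) (by simp [h])
    · exact h)
  have hf1 : (c * μ Q) ^ 2 * μ (B \ Q) ≤ (μ B * c) ^ 2 * μ Q := by
    calc (c * μ Q) ^ 2 * μ (B \ Q) = c ^ 2 * (μ Q * μ (B \ Q) * μ Q) := by ring
      _ ≤ c ^ 2 * (μ B * μ B * μ Q) := by
          gcongr
          exact sdiff_subset
      _ = _ := by ring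
  have hf2 : (c * μ (B \ Q)) ^ 2 * μ Q ≤ (μ B * c) ^ 2 * μ Q := by
    rw [mul_comm c]
    gcongr
    exact sdiff_subset
  calc sqIntLHS n μ B Q ≤ _ := add_le_add h1 h2
    _ ≤ (2 * (D ^ 2 * tildeSum L n α k Q) + 2 * D ^ 2 * S * tildeSum L n α k Q) +
        (2 * (D ^ 2 * tildeSum L n α k Q) + 2 * D ^ 2 * S * tildeSum L n α k Q) := by
        exact add_le_add
          (add_le_add (mul_le_mul_right (hf1.trans hfar) 2) le_rfl)
          (add_le_add (mul_le_mul_right (hf2.trans hfar) 2) le_rfl)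
    _ = _ := by ring

end DMLattice

/-- For any David–Mattila lattice for a compactly supported Radon measure `μ`
on `ℝ^d` and any `α ∈ (0,1)`, for every cube `Q`,
`∫_{2B_Q∖Q}(∫_Q |x-y|^{-n}dμ)²dμ + ∫_Q(∫_{2B_Q∖Q}|x-y|^{-n}dμ)²dμ
  ≤ C Σ_{P ∈ D̃_μ(Q)} (ℓ(Q)/ℓ(P))^α θ_μ(2B_P)² μ(P)`,
where `C` depends only on `α, A₀, C₀, d, n`. -/
theorem sqInt_le_tildeSum (d n : ℕ) (hn : 1 ≤ n) (hnd : n ≤ d) (C₀ A₀ α : ℝ)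
    (hα : α ∈ Ioo (0 : ℝ) 1) :
    ∃ C : ℝ, 0 < C ∧
      ∀ (μ : Measure (Euc d)), IsLocallyFiniteMeasure μ → IsCompact (measSupport μ) →
        ∀ L : DMLattice d μ C₀ A₀, ∀ k : ℕ, ∀ Q ∈ L.cubes k,
          sqIntLHS n μ (ball (L.center k Q) (56 * L.radius k Q)) Q ≤
            ENNReal.ofReal C * tildeSum L n α k Q := by
  by_cases hCA : 1 < C₀ ∧ 5000 * C₀ < A₀
  swap
  · exact ⟨1, one_pos, fun μ _ _ L => absurd ⟨L.hC₀, L.hA₀⟩ hCA⟩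
  obtain ⟨hC₀, hA₀⟩ := hCA
  have hA : 1 < A₀ := by linarith
  set K : ℝ≥0∞ := 4 * ENNReal.ofReal ((2 * C₀ * A₀) ^ n) ^ 2 *
    (1 + (1 - ENNReal.ofReal (A₀ ^ (-α)))⁻¹)
  have hlt : ENNReal.ofReal (A₀ ^ (-α)) < 1 :=
    ENNReal.ofReal_lt_one.2 (Real.rpow_lt_one_of_one_lt_of_neg hA (neg_lt_zero.2 hα.1))
  have hKtop : K ≠ ∞ := by
    refine ENNReal.mul_ne_top (ENNReal.mul_ne_top (by simp) (by simp)) ?_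
    exact ENNReal.add_ne_top.2 ⟨by simp, ENNReal.inv_ne_top.2 (tsub_pos_of_lt hlt).ne'⟩
  have hK0 : K ≠ 0 := by
    have : 0 < ENNReal.ofReal ((2 * C₀ * A₀) ^ n) := ENNReal.ofReal_pos.2 (by positivity)
    exact mul_ne_zero (mul_ne_zero (by simp) (pow_ne_zero _ this.ne')) (by simp)
  refine ⟨K.toReal, ENNReal.toReal_pos hK0 hKtop, fun μ _ _ L k Q hQ => ?_⟩
  rw [ENNReal.ofReal_toReal hKtop]
  exact L.sqIntLHS_le n α hQ
end
end

section
/- Let μ be a compactly supported Radon measure on ℝ^d and let D_μ be a David–Mattila lattice for μ with parameters C₀, A₀ and D_{μ,0} = {supp μ}. Let Q₀, Q₁, …, Q_m be cubes of D_μ such that Q_j is a child of Q_{j−1} (i.e. Q_j ⊂ Q_{j−1} and Q_j belongs to the next generation) for 1 ≤ j ≤ m, and suppose that none of Q₁, …, Q_m is P-doubling. Then μ(2B_{Q_m})/ℓ(Q_m)^n ≤ A₀^{−m/2} P(Q₀) and P(Q_m) ≤ 2 A₀^{−m/2} P(Q₀). -/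
open MeasureTheory Metric Set Filter Topology
open scoped ENNReal NNReal Classical

noncomputable section

/-- The Poisson-type coefficient `P(Q) = Σ_{R ∈ D_μ, R ⊇ Q} (ℓ(Q)/ℓ(R)^{n+1}) μ(2B_R)` for a
generation-`k` cube `Q` (the sum running over the ancestors of `Q`). -/
def coefP {d : ℕ} {μ : Measure (Euc d)} {C₀ A₀ : ℝ} (L : DMLattice d μ C₀ A₀)
    (n k : ℕ) (Q : Set (Euc d)) : ℝ≥0∞ :=
  ∑' (j : ℕ), ∑' (R : L.cubes j),
    if j ≤ k ∧ Q ⊆ (R : Set (Euc d)) then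
      ENNReal.ofReal (sideLen C₀ A₀ k / sideLen C₀ A₀ j ^ (n + 1)) *
        μ (ball (L.center j (R : Set (Euc d))) (56 * L.radius j (R : Set (Euc d))))
    else 0

/-- A generation-`k` cube `Q` is `P`-doubling if `P(Q) ≤ 4 A₀ⁿ μ(2B_Q)/ℓ(Q)ⁿ`. -/
def PDoubling {d : ℕ} {μ : Measure (Euc d)} {C₀ A₀ : ℝ} (L : DMLattice d μ C₀ A₀)
    (n k : ℕ) (Q : Set (Euc d)) : Prop :=
  coefP L n k Q ≤ ENNReal.ofReal (4 * A₀ ^ n) *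
    (μ (ball (L.center k Q) (56 * L.radius k Q)) / ENNReal.ofReal (sideLen C₀ A₀ k ^ n))

theorem DMLattice.A₀_pos {d : ℕ} {μ : Measure (Euc d)} {C₀ A₀ : ℝ} (L : DMLattice d μ C₀ A₀) :
    0 < A₀ := by
  linarith [L.hC₀, L.hA₀]

theorem DMLattice.sideLen_pos {d : ℕ} {μ : Measure (Euc d)} {C₀ A₀ : ℝ}
    (L : DMLattice d μ C₀ A₀) (k : ℕ) : 0 < sideLen C₀ A₀ k := by
  have h₁ := L.A₀_pos
  have h₂ : 0 < C₀ := by linarith [L.hC₀]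
  unfold sideLen
  positivity

theorem DMLattice.sideLen_succ {d : ℕ} {μ : Measure (Euc d)} {C₀ A₀ : ℝ}
    (L : DMLattice d μ C₀ A₀) (k : ℕ) :
    sideLen C₀ A₀ (k + 1) = A₀⁻¹ * sideLen C₀ A₀ k := by
  have h : (-((k + 1 : ℕ) : ℤ)) = -(k : ℤ) + -1 := by push_cast; ring
  unfold sideLen
  rw [h, zpow_add₀ L.A₀_pos.ne', zpow_neg_one]
  ring

theorem DMLattice.nonempty {d : ℕ} {μ : Measure (Euc d)} {C₀ A₀ : ℝ} (L : DMLattice d μ C₀ A₀)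
    {k : ℕ} {Q : Set (Euc d)} (hQ : Q ∈ L.cubes k) : Q.Nonempty :=
  ⟨L.center k Q, L.ball_subset k Q hQ ⟨L.center_mem k Q hQ,
    mem_ball_self ((zpow_pos L.A₀_pos _).trans_le (L.radius_lb k Q hQ))⟩⟩

/-- Two cubes of the same generation, one containing the other, coincide. -/
theorem DMLattice.eq_of_subset {d : ℕ} {μ : Measure (Euc d)} {C₀ A₀ : ℝ}
    (L : DMLattice d μ C₀ A₀) {k : ℕ} {Q R : Set (Euc d)} (hQ : Q ∈ L.cubes k)
    (hR : R ∈ L.cubes k) (h : Q ⊆ R) : Q = R := by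
  obtain ⟨x, hx⟩ := L.nonempty hQ
  by_contra hne
  exact Set.disjoint_left.1 (L.disj k hQ hR hne) hx (h hx)

/-- An ancestor of a child `Q'` of `Q`, of generation at most that of `Q`, contains `Q`. -/
theorem DMLattice.parent_subset {d : ℕ} {μ : Measure (Euc d)} {C₀ A₀ : ℝ}
    (L : DMLattice d μ C₀ A₀) {j k l : ℕ} {Q Q' R : Set (Euc d)} (hQ : Q ∈ L.cubes k)
    (hQ' : Q' ∈ L.cubes l) (hR : R ∈ L.cubes j) (hjk : j ≤ k) (hsub : Q' ⊆ Q) (h : Q' ⊆ R) :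
    Q ⊆ R := by
  obtain ⟨x, hx⟩ := L.nonempty hQ'
  rcases hjk.lt_or_eq with hlt | rfl
  · refine (L.nested j k hlt Q hQ R hR).resolve_left fun h0 => ?_
    exact Set.notMem_empty x (h0 ▸ ⟨hsub hx, h hx⟩)
  · by_contra hne
    refine Set.disjoint_left.1 (L.disj j hQ hR fun heq => hne heq.subset) (hsub hx) (h hx)

/-- The summand of `coefP` attached to the cube itself. -/
theorem DMLattice.self_term_eq {d : ℕ} {μ : Measure (Euc d)} {C₀ A₀ : ℝ}
    (L : DMLattice d μ C₀ A₀) (n k : ℕ) (t : ℝ≥0∞) :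
    ENNReal.ofReal (sideLen C₀ A₀ k / sideLen C₀ A₀ k ^ (n + 1)) * t =
      t / ENNReal.ofReal (sideLen C₀ A₀ k ^ n) := by
  have hs := L.sideLen_pos k
  have h : sideLen C₀ A₀ k / sideLen C₀ A₀ k ^ (n + 1) = (sideLen C₀ A₀ k ^ n)⁻¹ := by
    field_simp
    ring
  rw [h, ENNReal.ofReal_inv_of_pos (pow_pos hs n), mul_comm, ENNReal.div_eq_inv_mul, mul_comm]

theorem density_le_coefP {d : ℕ} {μ : Measure (Euc d)} {C₀ A₀ : ℝ} (L : DMLattice d μ C₀ A₀)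
    (n : ℕ) {k : ℕ} {Q : Set (Euc d)} (hQ : Q ∈ L.cubes k) :
    μ (ball (L.center k Q) (56 * L.radius k Q)) / ENNReal.ofReal (sideLen C₀ A₀ k ^ n) ≤
      coefP L n k Q := by
  unfold coefP
  refine le_trans ?_ (ENNReal.le_tsum k)
  refine le_trans ?_ (ENNReal.le_tsum (⟨Q, hQ⟩ : L.cubes k))
  rw [if_pos ⟨le_rfl, subset_rfl⟩, L.self_term_eq]

/-- Passing to a child multiplies the contribution of the older generations by `A₀⁻¹`. -/
theorem coefP_child_le {d : ℕ} {μ : Measure (Euc d)} {C₀ A₀ : ℝ} (L : DMLattice d μ C₀ A₀)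
    (n : ℕ) {k : ℕ} {Q Q' : Set (Euc d)} (hQ : Q ∈ L.cubes k) (hQ' : Q' ∈ L.cubes (k + 1))
    (hsub : Q' ⊆ Q) :
    coefP L n (k + 1) Q' ≤
      μ (ball (L.center (k + 1) Q') (56 * L.radius (k + 1) Q')) /
          ENNReal.ofReal (sideLen C₀ A₀ (k + 1) ^ n) +
        ENNReal.ofReal A₀⁻¹ * coefP L n k Q := by
  set a := μ (ball (L.center (k + 1) Q') (56 * L.radius (k + 1) Q')) /
    ENNReal.ofReal (sideLen C₀ A₀ (k + 1) ^ n)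
  have hsingle : ∑' (j : ℕ), ∑' (R : L.cubes j),
      (if j = k + 1 ∧ (R : Set (Euc d)) = Q' then a else 0) = a := by
    rw [tsum_eq_single (k + 1) (fun j hj => by simp [hj]),
      tsum_eq_single (⟨Q', hQ'⟩ : L.cubes (k + 1))
        (fun R hR => if_neg fun h => hR (Subtype.ext h.2))]
    simp
  conv_rhs => rw [← hsingle]
  unfold coefP
  rw [← ENNReal.tsum_mul_left, ← ENNReal.tsum_add]
  refine ENNReal.tsum_le_tsum fun j => ?_
  rw [← ENNReal.tsum_mul_left, ← ENNReal.tsum_add]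
  refine ENNReal.tsum_le_tsum fun R => ?_
  split_ifs with h₁ h₂ h₃ h₃
  · exact absurd h₃.1 (by omega)
  · obtain ⟨rfl, hR⟩ := h₂
    rw [hR, L.self_term_eq, mul_zero, add_zero]
  · rw [zero_add, ← mul_assoc, ← ENNReal.ofReal_mul (inv_nonneg.2 L.A₀_pos.le),
      L.sideLen_succ, mul_div_assoc]
  · exfalso
    obtain ⟨hj, hR⟩ := h₁
    rcases hj.lt_or_eq with hlt | rfl
    · have hjk : j ≤ k := by omega
      exact h₃ ⟨hjk, L.parent_subset hQ hQ' R.2 hjk hsub hR⟩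
    · exact h₂ ⟨rfl, (L.eq_of_subset hQ' R.2 hR).symm⟩
  all_goals exact zero_le

theorem coefP_child_le_of_not_pDoubling {d : ℕ} {μ : Measure (Euc d)} [IsLocallyFiniteMeasure μ]
    {C₀ A₀ : ℝ} (L : DMLattice d μ C₀ A₀) (n : ℕ) {k : ℕ} {Q Q' : Set (Euc d)}
    (hQ : Q ∈ L.cubes k) (hQ' : Q' ∈ L.cubes (k + 1)) (hsub : Q' ⊆ Q)
    (hnd : ¬ PDoubling L n (k + 1) Q') :
    coefP L n (k + 1) Q' ≤ ENNReal.ofReal (2 * A₀⁻¹) * coefP L n k Q := by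
  have hrec := coefP_child_le L n hQ hQ' hsub
  unfold PDoubling at hnd
  rw [not_le] at hnd
  set a := μ (ball (L.center (k + 1) Q') (56 * L.radius (k + 1) Q')) /
    ENNReal.ofReal (sideLen C₀ A₀ (k + 1) ^ n)
  have ha : a ≠ ∞ := ENNReal.div_ne_top measure_ball_lt_top.ne
    (ENNReal.ofReal_pos.2 (pow_pos (L.sideLen_pos _) n)).ne'
  have hA : (1 : ℝ) ≤ A₀ ^ n := one_le_pow₀ (by linarith [L.hC₀, L.hA₀])
  have h2 : (2 : ℝ≥0∞) ≤ ENNReal.ofReal (4 * A₀ ^ n) := by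
    rw [← ENNReal.ofReal_ofNat 2]
    exact ENNReal.ofReal_le_ofReal (by linarith)
  have h3 : a + a ≤ a + ENNReal.ofReal A₀⁻¹ * coefP L n k Q := by
    rw [← two_mul]
    exact (mul_le_mul_left h2 a).trans (hnd.le.trans hrec)
  have h4 := (ENNReal.add_le_add_iff_left ha).1 h3
  calc coefP L n (k + 1) Q' ≤ a + ENNReal.ofReal A₀⁻¹ * coefP L n k Q := hrec
    _ ≤ ENNReal.ofReal A₀⁻¹ * coefP L n k Q + ENNReal.ofReal A₀⁻¹ * coefP L n k Q := by gcongr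
    _ = ENNReal.ofReal (2 * A₀⁻¹) * coefP L n k Q := by
      rw [ENNReal.ofReal_mul zero_le_two, ENNReal.ofReal_ofNat, mul_assoc, two_mul]

/-- Geometric decay of `coefP` along a chain of non-`P`-doubling cubes. -/
theorem coefP_chain_le {d : ℕ} {μ : Measure (Euc d)} [IsLocallyFiniteMeasure μ]
    {C₀ A₀ : ℝ} (L : DMLattice d μ C₀ A₀) (n k₀ m : ℕ) (Q : ℕ → Set (Euc d))
    (hmem : ∀ j : ℕ, j ≤ m → Q j ∈ L.cubes (k₀ + j))
    (hchild : ∀ j : ℕ, 1 ≤ j → j ≤ m → Q j ⊆ Q (j - 1))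
    (hnd : ∀ j : ℕ, 1 ≤ j → j ≤ m → ¬ PDoubling L n (k₀ + j) (Q j)) :
    coefP L n (k₀ + m) (Q m) ≤ ENNReal.ofReal ((2 * A₀⁻¹) ^ m) * coefP L n k₀ (Q 0) := by
  have hpos : (0 : ℝ) ≤ 2 * A₀⁻¹ := mul_nonneg zero_le_two (inv_nonneg.2 L.A₀_pos.le)
  induction m with
  | zero => simp
  | succ m ih =>
    have hprev := ih (fun j hj => hmem j (by omega)) (fun j h hj => hchild j h (by omega))
      (fun j h hj => hnd j h (by omega))
    have hstep := coefP_child_le_of_not_pDoubling L n (hmem m (by omega)) (hmem (m + 1) le_rfl)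
      (hchild (m + 1) (by omega) le_rfl) (hnd (m + 1) (by omega) le_rfl)
    calc coefP L n (k₀ + (m + 1)) (Q (m + 1))
        ≤ ENNReal.ofReal (2 * A₀⁻¹) * coefP L n (k₀ + m) (Q m) := hstep
      _ ≤ ENNReal.ofReal (2 * A₀⁻¹) *
          (ENNReal.ofReal ((2 * A₀⁻¹) ^ m) * coefP L n k₀ (Q 0)) := by gcongr
      _ = ENNReal.ofReal ((2 * A₀⁻¹) ^ (m + 1)) * coefP L n k₀ (Q 0) := by
        rw [← mul_assoc, ← ENNReal.ofReal_mul hpos, pow_succ' (2 * A₀⁻¹)]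

theorem two_mul_inv_pow_le_rpow {A : ℝ} (hA : 4 ≤ A) (m : ℕ) :
    (2 * A⁻¹) ^ m ≤ A ^ (-(m : ℝ) / 2) := by
  have h0 : 0 < A := by linarith
  have hexp : A ^ (-(m : ℝ) / 2) = ((√A)⁻¹) ^ m := by
    rw [Real.sqrt_eq_rpow, ← Real.rpow_neg h0.le, ← Real.rpow_natCast, ← Real.rpow_mul h0.le]
    ring_nf
  rw [hexp]
  have hs : 0 < √A := Real.sqrt_pos.2 h0
  have h2 : 2 ≤ √A := Real.le_sqrt_of_sq_le (by linarith)
  refine pow_le_pow_left₀ (by positivity) ?_ m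
  rw [← div_eq_mul_inv, div_le_iff₀ h0]
  calc (2 : ℝ) ≤ √A := h2
    _ = (√A)⁻¹ * A := by
      nth_rewrite 3 [← Real.mul_self_sqrt h0.le]
      field_simp

/-- If `Q₀ ⊇ Q₁ ⊇ ⋯ ⊇ Q_m` is a chain of cubes, each a child of the previous
one, and none of `Q₁, …, Q_m` is `P`-doubling, then `μ(2B_{Q_m})/ℓ(Q_m)ⁿ ≤ A₀^{-m/2} P(Q₀)` and
`P(Q_m) ≤ 2 A₀^{-m/2} P(Q₀)`. -/
theorem non_pdoubling_chain_decay (d n : ℕ) (hn : 1 ≤ n) (hnd : n ≤ d) (C₀ A₀ : ℝ)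
    (μ : Measure (Euc d)) (hloc : IsLocallyFiniteMeasure μ) (hcs : IsCompact (measSupport μ))
    (L : DMLattice d μ C₀ A₀) (hroot : L.cubes 0 = {measSupport μ})
    (k₀ m : ℕ) (Q : ℕ → Set (Euc d))
    (hmem : ∀ j : ℕ, j ≤ m → Q j ∈ L.cubes (k₀ + j))
    (hchild : ∀ j : ℕ, 1 ≤ j → j ≤ m → Q j ⊆ Q (j - 1))
    (hnd' : ∀ j : ℕ, 1 ≤ j → j ≤ m → ¬ PDoubling L n (k₀ + j) (Q j)) :
    μ (ball (L.center (k₀ + m) (Q m)) (56 * L.radius (k₀ + m) (Q m))) /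
        ENNReal.ofReal (sideLen C₀ A₀ (k₀ + m) ^ n) ≤
      ENNReal.ofReal (A₀ ^ (-(m : ℝ) / 2)) * coefP L n k₀ (Q 0) ∧
    coefP L n (k₀ + m) (Q m) ≤
      ENNReal.ofReal (2 * A₀ ^ (-(m : ℝ) / 2)) * coefP L n k₀ (Q 0) := by
  have hA : 4 ≤ A₀ := by linarith [L.hC₀, L.hA₀]
  have hP : coefP L n (k₀ + m) (Q m) ≤
      ENNReal.ofReal (A₀ ^ (-(m : ℝ) / 2)) * coefP L n k₀ (Q 0) :=
    (coefP_chain_le L n k₀ m Q hmem hchild hnd').trans <| by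
      gcongr
      exact two_mul_inv_pow_le_rpow hA m
  refine ⟨(density_le_coefP L n (hmem m le_rfl)).trans hP, hP.trans ?_⟩
  gcongr
  linarith [Real.rpow_nonneg L.A₀_pos.le (-(m : ℝ) / 2)]
end
end
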